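/- Let Y be a normally distributed real random variable with mean μ_Y and standard deviation σ_Y > 0, and let M > 0. Then E[max(e^Y − M, 0)] = E[e^Y]·N(h₊) − M·N(h₋), where h₊ = (log(E[e^Y]/M) + σ_Y²/2)/σ_Y and h₋ = (log(E[e^Y]/M) − σ_Y²/2)/σ_Y. -/

import Mathlib

open MeasureTheory ProbabilityTheory Real

/-- The standard normal cumulative distribution function
`N(x) = (1/√(2π)) ∫_{−∞}^{x} e^{−y²/2} dy`. -/
noncomputable def stdNormalCDF (x : ℝ) : ℝ :=
  (gaussianReal 0 1 (Set.Iic x)).toReal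

/-- The probability that a normal variable exceeds `a`, by reflecting and standardizing it. -/
lemma measureReal_gaussianReal_Ici (m a : ℝ) {σ : ℝ} (hσ : 0 < σ) :
    (gaussianReal m (σ ^ 2).toNNReal).real (Set.Ici a) = stdNormalCDF ((m - a) / σ) := by
  have hmap : (gaussianReal 0 1).map (fun x ↦ m - σ * x)
      = gaussianReal m (σ ^ 2).toNNReal := by
    have hcomp : (fun x ↦ m - σ * x) = (fun x ↦ m - x) ∘ (fun x ↦ σ * x) := rfl
    rw [hcomp, ← Measure.map_map (by fun_prop) (by fun_prop), gaussianReal_map_const_mul,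
      gaussianReal_map_const_sub]
    congr 1
    · simp
    · ext
      simp [sq_nonneg]
  have hpre : (fun x ↦ m - σ * x) ⁻¹' Set.Ici a = Set.Iic ((m - a) / σ) := by
    ext x
    simp only [Set.mem_preimage, Set.mem_Ici, Set.mem_Iic, le_div_iff₀ hσ]
    constructor <;> intro h <;> linarith
  rw [← hmap, measureReal_def, Measure.map_apply (by fun_prop) measurableSet_Ici, hpre,
    stdNormalCDF]

/-- Exponential tilting turns a normal density into a shifted normal density. -/
lemma gaussianPDFReal_mul_exp (m x : ℝ) {v : NNReal} (hv : v ≠ 0) :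
    gaussianPDFReal m v x * exp x = exp (m + v / 2) * gaussianPDFReal (m + v) v x := by
  have hv' : (v : ℝ) ≠ 0 := by exact_mod_cast hv
  simp only [gaussianPDFReal]
  rw [mul_assoc, ← exp_add, mul_left_comm, ← exp_add]
  congr 2
  field_simp
  ring

/-- The partial expectation of a lognormal variable. -/
lemma setIntegral_exp_gaussianReal (m : ℝ) {v : NNReal} (hv : v ≠ 0) {s : Set ℝ}
    (hs : MeasurableSet s) :
    ∫ x in s, exp x ∂gaussianReal m v = exp (m + v / 2) * (gaussianReal (m + v) v).real s := by
  rw [← integral_indicator hs, integral_gaussianReal_eq_integral_smul hv, measureReal_def,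
    gaussianReal_apply_eq_integral _ hv, ENNReal.toReal_ofReal
      (integral_nonneg fun x ↦ gaussianPDFReal_nonneg _ _ x),
    ← integral_const_mul, ← integral_indicator hs]
  congr 1
  ext x
  by_cases hx : x ∈ s
  · simp [hx, gaussianPDFReal_mul_exp m x hv]
  · simp [hx]

/-- For a normal random variable `Y` with mean `μY`, standard deviation `σY > 0`, and `M > 0`,
`E[max(e^Y − M, 0)] = E[e^Y]·N(h₊) − M·N(h₋)` where
`h± = (log(E[e^Y]/M) ± σY²/2)/σY`. -/
theorem expectation_max_exp_sub
    {Ω : Type*} [MeasurableSpace Ω] (P : Measure Ω) [IsProbabilityMeasure P]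
    (Y : Ω → ℝ) (hYmeas : Measurable Y)
    (μY σY M : ℝ) (hσ : 0 < σY) (hM : 0 < M)
    (hY : Measure.map Y P = gaussianReal μY (σY ^ 2).toNNReal) :
    ∫ ω, max (Real.exp (Y ω) - M) 0 ∂P
      = (∫ ω, Real.exp (Y ω) ∂P)
            * stdNormalCDF ((Real.log ((∫ ω, Real.exp (Y ω) ∂P) / M) + σY ^ 2 / 2) / σY)
        - M * stdNormalCDF ((Real.log ((∫ ω, Real.exp (Y ω) ∂P) / M) - σY ^ 2 / 2) / σY) := by
  have hv : (σY ^ 2).toNNReal ≠ 0 := (Real.toNNReal_pos.mpr (by positivity)).ne'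
  have hcoe : ((σY ^ 2).toNNReal : ℝ) = σY ^ 2 := Real.coe_toNNReal _ (sq_nonneg _)
  have hmean : ∫ ω, exp (Y ω) ∂P = exp (μY + σY ^ 2 / 2) := by
    simpa [mgf, hcoe] using mgf_gaussianReal hY 1
  have hint : Integrable exp (gaussianReal μY (σY ^ 2).toNNReal) := by
    simpa using integrable_exp_mul_gaussianReal (μ := μY) (v := (σY ^ 2).toNNReal) 1
  have hpayoff : (fun x ↦ max (exp x - M) 0)
      = (Set.Ici (log M)).indicator fun x ↦ exp x - M := by
    ext x
    by_cases hx : log M ≤ x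
    · rw [Set.indicator_of_mem (Set.mem_Ici.mpr hx),
        max_eq_left (sub_nonneg.mpr ((log_le_iff_le_exp hM).mp hx))]
    · rw [Set.indicator_of_notMem (by simpa using hx),
        max_eq_right (sub_nonpos.mpr ((lt_log_iff_exp_lt hM).mp (not_le.mp hx)).le)]
  have hlog : log (exp (μY + σY ^ 2 / 2) / M) = μY + σY ^ 2 / 2 - log M := by
    rw [log_div (exp_pos _).ne' hM.ne', log_exp]
  calc ∫ ω, max (exp (Y ω) - M) 0 ∂P
      = ∫ x, max (exp x - M) 0 ∂gaussianReal μY (σY ^ 2).toNNReal := by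
        rw [← hY, integral_map hYmeas.aemeasurable (by fun_prop)]
    _ = (∫ x in Set.Ici (log M), exp x ∂gaussianReal μY (σY ^ 2).toNNReal)
          - M * (gaussianReal μY (σY ^ 2).toNNReal).real (Set.Ici (log M)) := by
        rw [hpayoff, integral_indicator measurableSet_Ici,
          integral_sub hint.integrableOn (integrable_const M), setIntegral_const, smul_eq_mul,
          mul_comm M]
    _ = _ := by
        rw [setIntegral_exp_gaussianReal _ hv measurableSet_Ici,
          measureReal_gaussianReal_Ici _ _ hσ, measureReal_gaussianReal_Ici _ _ hσ, hmean, hlog,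
          hcoe]
        ring_nf
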